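/- If X is a geometric random variable on {1, 2, 3, …} with success probability p ∈ (0,1], i.e. Pr(X = k) = (1 − p)^{k−1} p, and mean μ = 1/p, then its Shannon entropy satisfies H(X) ≤ log₂ μ + log₂ e. -/

import Mathlib

/-- Binary (base-2) entropy contribution of a probability value `t`:
`ent2 t = -(t * log₂ t)` (with the convention `log₂ 0 = 0`). -/
noncomputable def ent2 (t : ℝ) : ℝ := -(t * Real.logb 2 t)

theorem ent2_pow_mul (q : ℝ) {p : ℝ} (hp : 0 < p) (k : ℕ) :
    ent2 (q ^ k * p) = -(p * Real.logb 2 p) * q ^ k + -(p * Real.logb 2 q) * (k * q ^ k) := by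
  rcases eq_or_ne (q ^ k) 0 with h | h
  · simp [ent2, h]
  · rw [ent2, Real.logb_mul h hp.ne', Real.logb_pow]
    ring

/-- The exact entropy, in bits, of a geometric distribution. -/
theorem hasSum_ent2_geometric {p : ℝ} (hp : p ∈ Set.Ioc (0 : ℝ) 1) :
    HasSum (fun k : ℕ => ent2 ((1 - p) ^ k * p))
      (Real.logb 2 (1 / p) - (1 - p) / p * Real.logb 2 (1 - p)) := by
  obtain ⟨h0, h1⟩ := hp
  have hq : ‖1 - p‖ < 1 := by
    rw [Real.norm_eq_abs, abs_lt]
    constructor <;> linarith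
  have hsum := ((hasSum_geometric_of_norm_lt_one hq).mul_left (-(p * Real.logb 2 p))).add
    ((hasSum_coe_mul_geometric_of_norm_lt_one hq).mul_left (-(p * Real.logb 2 (1 - p))))
  simp_rw [ent2_pow_mul (1 - p) h0]
  refine Eq.subst (motive := fun a => HasSum _ a) ?_ hsum
  rw [one_div, Real.logb_inv, sub_sub_cancel]
  field_simp
  ring

theorem neg_mul_log_le_one_sub {q : ℝ} (hq : 0 ≤ q) : -(q * Real.log q) ≤ 1 - q := by
  rcases hq.eq_or_lt with rfl | h
  · simp
  · have := mul_le_mul_of_nonneg_left (Real.one_sub_inv_le_log_of_pos h) hq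
    rw [mul_sub, mul_inv_cancel₀ h.ne'] at this
    linarith

/-- **Entropy bound for geometric random variables.**
If `X` is geometric on `{1, 2, 3, …}` with success probability `p ∈ (0,1]`,
i.e. `Pr(X = k) = (1 - p)^(k-1) * p` (here the index `k : ℕ` runs over `0, 1, 2, …`
representing the value `k + 1`), and mean `μ = 1/p`, then its Shannon entropy (in bits)
satisfies `H(X) ≤ log₂ μ + log₂ e`. -/
theorem geometric_entropy_le (p : ℝ) (hp : p ∈ Set.Ioc (0 : ℝ) 1) :
    (∑' k : ℕ, ent2 ((1 - p) ^ k * p)) ≤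
      Real.logb 2 (1 / p) + Real.logb 2 (Real.exp 1) := by
  rw [(hasSum_ent2_geometric hp).tsum_eq, sub_eq_add_neg]
  gcongr
  have h0 : 0 < p := hp.1
  have h := neg_mul_log_le_one_sub (sub_nonneg.2 hp.2)
  have hlog : 0 < Real.log 2 := Real.log_pos one_lt_two
  rw [Real.logb, Real.logb, Real.log_exp, div_mul_div_comm, ← neg_div,
    div_le_div_iff₀ (by positivity) hlog]
  nlinarith
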